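/- arXiv:2403.08741 — 3 statements merged into one kernel-verified Lean document; each statement's English description precedes it below -/
import Mathlib

section
/- Let Σ₀ be a d×d real positive definite matrix and let γ = max_i (Σ₀)_{ii}. Then the function X ↦ −log det(X) is α-strongly convex with respect to the Frobenius norm on the set of positive definite matrices X with X ⪯ Σ₀, with α = 1/(1152 γ² d³ √e); that is, for all positive definite X, Y with X ⪯ Σ₀ and Y ⪯ Σ₀ and all t ∈ [0,1]: −log det(tX + (1−t)Y) ≤ −t log det(X) − (1−t) log det(Y) − (t(1−t)/2) · (1/(1152 γ² d³ √e)) · ‖X − Y‖_F². (Strong convexity claim of Lemma 3 for the differential-entropy signaling cost.) -/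
open Matrix

/-- The Frobenius norm of a real matrix. -/
noncomputable def frobNorm {d : ℕ} (A : Matrix (Fin d) (Fin d) ℝ) : ℝ :=
  Real.sqrt (∑ i, ∑ j, (A i j) ^ 2)

/-- A quantitative form of `log x ≤ x - 1`. -/
theorem log_sub_log_le_of_le {a m M : ℝ} (ha : 0 < a) (hm : 0 < m) (haM : a ≤ M) (hmM : m ≤ M) :
    Real.log a - Real.log m ≤ (a - m) / m - (a - m) ^ 2 / (4 * M ^ 2) := by
  obtain ⟨p, hp, rfl⟩ : ∃ p : ℝ, 0 < p ∧ p ^ 2 = a := ⟨√a, by positivity, Real.sq_sqrt ha.le⟩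
  obtain ⟨q, hq, rfl⟩ : ∃ q : ℝ, 0 < q ∧ q ^ 2 = m := ⟨√m, by positivity, Real.sq_sqrt hm.le⟩
  have hM : 0 < M := ha.trans_le haM
  have hlog : Real.log (p ^ 2) - Real.log (q ^ 2) ≤ 2 * (p / q - 1) := by
    have h := Real.log_le_sub_one_of_pos (div_pos hp hq)
    rw [Real.log_div hp.ne' hq.ne'] at h
    rw [Real.log_pow, Real.log_pow]
    push_cast
    linarith
  have hsq : (p ^ 2 - q ^ 2) ^ 2 / (4 * M ^ 2) ≤ (p - q) ^ 2 / q ^ 2 := by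
    have h₁ : (p + q) ^ 2 ≤ 4 * M := by nlinarith [sq_nonneg (p - q)]
    have h₂ : (p + q) ^ 2 * q ^ 2 ≤ 4 * M ^ 2 := by
      calc (p + q) ^ 2 * q ^ 2 ≤ 4 * M * M := by gcongr
        _ = 4 * M ^ 2 := by ring
    rw [div_le_div_iff₀ (by positivity) (by positivity)]
    calc (p ^ 2 - q ^ 2) ^ 2 * q ^ 2 = (p - q) ^ 2 * ((p + q) ^ 2 * q ^ 2) := by ring
      _ ≤ (p - q) ^ 2 * (4 * M ^ 2) := by gcongr
  have hid : (p ^ 2 - q ^ 2) / q ^ 2 = 2 * (p / q - 1) + (p - q) ^ 2 / q ^ 2 := by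
    field_simp
    ring
  linarith

/-- Strong concavity of `log` on `(0, M]`. -/
theorem log_strongConcave_of_le {a b M t : ℝ} (ha : 0 < a) (hb : 0 < b) (haM : a ≤ M)
    (hbM : b ≤ M) (ht₀ : 0 ≤ t) (ht₁ : t ≤ 1) :
    t * (1 - t) * (a - b) ^ 2 / (4 * M ^ 2) ≤
      Real.log (t * a + (1 - t) * b) - t * Real.log a - (1 - t) * Real.log b := by
  have hs : 0 ≤ 1 - t := sub_nonneg.2 ht₁
  have hm : 0 < t * a + (1 - t) * b := (convex_Ioi (0 : ℝ)) ha hb ht₀ hs (by ring)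
  have hmM : t * a + (1 - t) * b ≤ M := (convex_Iic M) haM hbM ht₀ hs (by ring)
  have h₁ := mul_le_mul_of_nonneg_left (log_sub_log_le_of_le ha hm haM hmM) ht₀
  have h₂ := mul_le_mul_of_nonneg_left (log_sub_log_le_of_le hb hm hbM hmM) hs
  set m := t * a + (1 - t) * b with hmdef
  have hlin : t * ((a - m) / m) + (1 - t) * ((b - m) / m) = 0 := by
    rw [← mul_div_assoc, ← mul_div_assoc, ← add_div, hmdef]
    ring
  have hquad : t * ((a - m) ^ 2 / (4 * M ^ 2)) + (1 - t) * ((b - m) ^ 2 / (4 * M ^ 2)) =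
      t * (1 - t) * (a - b) ^ 2 / (4 * M ^ 2) := by
    rw [← mul_div_assoc, ← mul_div_assoc, ← add_div, hmdef]
    ring
  linarith

/-- The real spectral theorem for positive definite matrices, with transposes. -/
theorem Matrix.PosDef.exists_eq_mul_diagonal_mul_transpose {n : Type*} [Fintype n] [DecidableEq n]
    {A : Matrix n n ℝ} (hA : A.PosDef) :
    ∃ (U : Matrix n n ℝ) (v : n → ℝ), (∀ i, 0 < v i) ∧ U * Uᵀ = 1 ∧ A = U * diagonal v * Uᵀ := by
  refine ⟨hA.1.eigenvectorUnitary, hA.1.eigenvalues, hA.eigenvalues_pos, ?_, ?_⟩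
  · have h := Unitary.coe_mul_star_self hA.1.eigenvectorUnitary
    rwa [Unitary.coe_star, star_eq_conjTranspose, conjTranspose_eq_transpose_of_trivial] at h
  · have h := hA.1.spectral_theorem
    rw [Unitary.conjStarAlgAut_apply, star_eq_conjTranspose,
      conjTranspose_eq_transpose_of_trivial] at h
    exact h

/-- Simultaneous diagonalization of two positive definite matrices by congruence. -/
theorem Matrix.PosDef.exists_simultaneous_diagonalization {n : Type*} [Fintype n] [DecidableEq n]
    {X Y : Matrix n n ℝ} (hX : X.PosDef) (hY : Y.PosDef) :
    ∃ (Q : Matrix n n ℝ) (v : n → ℝ), (∀ i, 0 < v i) ∧ X = Q * Qᵀ ∧ Y = Q * diagonal v * Qᵀ := by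
  obtain ⟨U, u, hu, -, hXU⟩ := hX.exists_eq_mul_diagonal_mul_transpose
  obtain ⟨C, hC⟩ : ∃ C : Matrix n n ℝ, X = C * Cᵀ := by
    refine ⟨U * diagonal fun i => √(u i), ?_⟩
    rw [transpose_mul, diagonal_transpose, Matrix.mul_assoc, ← Matrix.mul_assoc (diagonal _),
      diagonal_mul_diagonal]
    simp_rw [fun i => Real.mul_self_sqrt (hu i).le]
    rw [← Matrix.mul_assoc]
    exact hXU
  have hCdet : IsUnit C.det := by
    have h := hX.det_pos
    rw [hC, det_mul, det_transpose] at h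
    exact isUnit_iff_ne_zero.2 (left_ne_zero_of_mul h.ne')
  have hZ : (C⁻¹ * Y * (C⁻¹)ᵀ).PosDef := by
    have hinv : IsUnit C⁻¹ := (isUnit_nonsing_inv_iff).2 ((isUnit_iff_isUnit_det C).2 hCdet)
    have h := (IsUnit.posDef_star_right_conjugate_iff hinv).2 hY
    rwa [star_eq_conjTranspose, conjTranspose_eq_transpose_of_trivial] at h
  obtain ⟨V, v, hv, hV, hZV⟩ := hZ.exists_eq_mul_diagonal_mul_transpose
  refine ⟨C * V, v, hv, ?_, ?_⟩
  · rw [transpose_mul, Matrix.mul_assoc, ← Matrix.mul_assoc V, hV, Matrix.one_mul, hC]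
  · have hCt : (C⁻¹)ᵀ * Cᵀ = 1 := by
      rw [← transpose_mul, mul_nonsing_inv _ hCdet, transpose_one]
    calc Y = C * C⁻¹ * Y * ((C⁻¹)ᵀ * Cᵀ) := by
          rw [mul_nonsing_inv _ hCdet, hCt, Matrix.one_mul, Matrix.mul_one]
      _ = C * (C⁻¹ * Y * (C⁻¹)ᵀ) * Cᵀ := by simp only [Matrix.mul_assoc]
      _ = C * V * diagonal v * (C * V)ᵀ := by
          rw [hZV, transpose_mul]
          simp only [Matrix.mul_assoc]

theorem Matrix.mul_diagonal_mul_transpose_apply {m n R : Type*} [Fintype n] [DecidableEq n]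
    [CommSemiring R] (Q : Matrix m n R) (v : n → R) (j k : m) :
    (Q * diagonal v * Qᵀ) j k = ∑ i, v i * (Q j i * Q k i) := by
  simp only [mul_apply (N := Qᵀ), mul_diagonal, transpose_apply]
  exact Finset.sum_congr rfl fun i _ => by ring

theorem Matrix.trace_mul_diagonal_mul_transpose {m n R : Type*} [Fintype m] [Fintype n]
    [DecidableEq n] [CommSemiring R] (Q : Matrix m n R) (v : n → R) :
    (Q * diagonal v * Qᵀ).trace = ∑ i, v i * ∑ j, Q j i ^ 2 := by
  simp only [trace, diag_apply, mul_diagonal_mul_transpose_apply, Finset.mul_sum, sq]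
  exact Finset.sum_comm

theorem frobNorm_sq {d : ℕ} (A : Matrix (Fin d) (Fin d) ℝ) :
    frobNorm A ^ 2 = ∑ i, ∑ j, A i j ^ 2 :=
  Real.sq_sqrt (by positivity)

theorem frobNorm_mul_diagonal_mul_transpose_sq_le {d : ℕ} (Q : Matrix (Fin d) (Fin d) ℝ)
    (v : Fin d → ℝ) :
    frobNorm (Q * diagonal v * Qᵀ) ^ 2 ≤ d * ∑ i, (v i * ∑ j, Q j i ^ 2) ^ 2 := by
  rw [frobNorm_sq]
  calc ∑ j, ∑ k, (Q * diagonal v * Qᵀ) j k ^ 2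
      ≤ ∑ j, ∑ k, d * ∑ i, (v i * (Q j i * Q k i)) ^ 2 := by
        gcongr with j _ k _
        rw [mul_diagonal_mul_transpose_apply]
        simpa using sq_sum_le_card_mul_sum_sq (s := Finset.univ)
          (f := fun i => v i * (Q j i * Q k i))
    _ = d * ∑ i, (v i * ∑ j, Q j i ^ 2) ^ 2 := by
        simp only [← Finset.mul_sum]
        congr 1
        rw [Finset.sum_congr rfl fun j _ => Finset.sum_comm, Finset.sum_comm]
        refine Finset.sum_congr rfl fun i _ => ?_
        rw [mul_pow, sq (∑ j, Q j i ^ 2), Finset.sum_mul_sum, Finset.mul_sum]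
        refine Finset.sum_congr rfl fun j _ => ?_
        rw [Finset.mul_sum]
        exact Finset.sum_congr rfl fun k _ => by ring

/-- If `Q (diag v) Qᵀ` has trace at most `M`, so does each of its rank-one summands. -/
theorem Matrix.mul_sum_sq_le_of_trace_le {m n : Type*} [Fintype m] [Fintype n] [DecidableEq n]
    {Q : Matrix m n ℝ} {v : n → ℝ} {M : ℝ} (hv : ∀ i, 0 ≤ v i)
    (h : (Q * diagonal v * Qᵀ).trace ≤ M) (i : n) : v i * ∑ j, Q j i ^ 2 ≤ M := by
  rw [trace_mul_diagonal_mul_transpose] at h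
  refine le_trans ?_ h
  exact Finset.single_le_sum (f := fun i => v i * ∑ j, Q j i ^ 2)
    (fun k _ => mul_nonneg (hv k) (by positivity)) (Finset.mem_univ i)

/-- `log det` is strongly concave on positive definite matrices of trace at most `M`. -/
theorem log_det_strongConcave_of_trace_le {d : ℕ} {X Y : Matrix (Fin d) (Fin d) ℝ}
    (hX : X.PosDef) (hY : Y.PosDef) {M : ℝ} (hM : 0 < M) (hXM : X.trace ≤ M) (hYM : Y.trace ≤ M)
    {t : ℝ} (ht₀ : 0 ≤ t) (ht₁ : t ≤ 1) :
    t * (1 - t) * frobNorm (X - Y) ^ 2 / (4 * d * M ^ 2) ≤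
      Real.log (t • X + (1 - t) • Y).det - t * Real.log X.det - (1 - t) * Real.log Y.det := by
  have hs : 0 ≤ 1 - t := sub_nonneg.2 ht₁
  obtain ⟨Q, v, hv, hXQ, hYQ⟩ := hX.exists_simultaneous_diagonalization hY
  have hXQ' : X = Q * diagonal (fun _ => 1) * Qᵀ := by rw [diagonal_one, Matrix.mul_one, hXQ]
  have hcomb : t • X + (1 - t) • Y = Q * diagonal (fun i => t * 1 + (1 - t) * v i) * Qᵀ := by
    ext j k
    rw [hXQ', hYQ, Matrix.add_apply, Matrix.smul_apply, Matrix.smul_apply]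
    simp only [mul_diagonal_mul_transpose_apply, smul_eq_mul, Finset.mul_sum,
      ← Finset.sum_add_distrib]
    exact Finset.sum_congr rfl fun i _ => by ring
  have hsub : X - Y = Q * diagonal (fun i => 1 - v i) * Qᵀ := by
    ext j k
    rw [hXQ', hYQ, Matrix.sub_apply]
    simp only [mul_diagonal_mul_transpose_apply, ← Finset.sum_sub_distrib]
    exact Finset.sum_congr rfl fun i _ => by ring
  have hQ : Q.det ≠ 0 := by
    have h := hX.det_pos
    rw [hXQ, det_mul] at h
    exact left_ne_zero_of_mul h.ne'
  have hlog : ∀ w : Fin d → ℝ, (∀ i, 0 < w i) →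
      Real.log (Q * diagonal w * Qᵀ).det = 2 * Real.log Q.det + ∑ i, Real.log (w i) := by
    intro w hw
    have hw' : ∏ i, w i ≠ 0 := (Finset.prod_pos fun i _ => hw i).ne'
    rw [det_mul, det_mul, det_diagonal, det_transpose,
      Real.log_mul (mul_ne_zero hQ hw') hQ, Real.log_mul hQ hw',
      Real.log_prod fun i _ => (hw i).ne']
    ring
  have hmix : ∀ i, 0 < t * 1 + (1 - t) * v i := fun i =>
    (convex_Ioi (0 : ℝ)) (Set.mem_Ioi.2 one_pos) (hv i) ht₀ hs (by ring)
  have hterm : ∀ i, t * (1 - t) / (4 * M ^ 2) * ((1 - v i) * ∑ j, Q j i ^ 2) ^ 2 ≤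
      Real.log (t * 1 + (1 - t) * v i) - t * Real.log 1 - (1 - t) * Real.log (v i) := by
    intro i
    have hK : 0 < max 1 (v i) := lt_max_of_lt_left one_pos
    refine le_trans ?_ (log_strongConcave_of_le one_pos (hv i) (le_max_left 1 (v i))
      (le_max_right 1 (v i)) ht₀ ht₁)
    have h₁ : 1 * ∑ j, Q j i ^ 2 ≤ M :=
      mul_sum_sq_le_of_trace_le (v := fun _ => 1) (fun _ => zero_le_one) (hXQ' ▸ hXM) i
    have h₂ : v i * ∑ j, Q j i ^ 2 ≤ M :=
      mul_sum_sq_le_of_trace_le (fun k => (hv k).le) (hYQ ▸ hYM) i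
    have hc : 0 ≤ ∑ j, Q j i ^ 2 := by positivity
    have hKM : max 1 (v i) * ∑ j, Q j i ^ 2 ≤ M := by
      rw [max_mul_of_nonneg _ _ hc]
      exact max_le h₁ h₂
    rw [div_mul_eq_mul_div, div_le_div_iff₀ (by positivity) (by positivity)]
    calc t * (1 - t) * ((1 - v i) * ∑ j, Q j i ^ 2) ^ 2 * (4 * max 1 (v i) ^ 2)
        = t * (1 - t) * (1 - v i) ^ 2 * (4 * (max 1 (v i) * ∑ j, Q j i ^ 2) ^ 2) := by ring
      _ ≤ t * (1 - t) * (1 - v i) ^ 2 * (4 * M ^ 2) := by gcongr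
  have hsum := Finset.sum_le_sum fun i (_ : i ∈ Finset.univ) => hterm i
  rw [← Finset.mul_sum] at hsum
  have hlogX : Real.log X.det = 2 * Real.log Q.det + ∑ _i : Fin d, Real.log 1 := by
    rw [hXQ', hlog _ fun _ => one_pos]
  have hlogY : Real.log Y.det = 2 * Real.log Q.det + ∑ i, Real.log (v i) := by
    rw [hYQ, hlog _ hv]
  have hgap : Real.log (t • X + (1 - t) • Y).det - t * Real.log X.det - (1 - t) * Real.log Y.det =
      ∑ i, (Real.log (t * 1 + (1 - t) * v i) - t * Real.log 1 - (1 - t) * Real.log (v i)) := by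
    rw [hcomb, hlog _ hmix, hlogX, hlogY, Finset.sum_sub_distrib, Finset.sum_sub_distrib,
      ← Finset.mul_sum, ← Finset.mul_sum]
    ring
  rw [hgap]
  refine le_trans ?_ hsum
  have hfrob := frobNorm_mul_diagonal_mul_transpose_sq_le Q fun i => 1 - v i
  rw [← hsub] at hfrob
  calc t * (1 - t) * frobNorm (X - Y) ^ 2 / (4 * d * M ^ 2)
      ≤ t * (1 - t) * (d * ∑ i, ((1 - v i) * ∑ j, Q j i ^ 2) ^ 2) / (4 * d * M ^ 2) := by gcongr
    _ ≤ t * (1 - t) / (4 * M ^ 2) * ∑ i, ((1 - v i) * ∑ j, Q j i ^ 2) ^ 2 := by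
        rcases d.eq_zero_or_pos with rfl | hd
        · simp
        · apply le_of_eq
          field_simp

/-- Lemma 3 (strong convexity of the differential-entropy signaling cost):
`X ↦ −log det X` is `α`-strongly convex w.r.t. the Frobenius norm on
`{X positive definite : X ⪯ Σ₀}`, with `α = 1/(1152 γ² d³ √e)` where `γ = maxᵢ (Σ₀)ᵢᵢ`. -/
theorem stmt_3 {d : ℕ} (S₀ : Matrix (Fin d) (Fin d) ℝ) (hS₀ : S₀.PosDef) (γ : ℝ)
    (hγ : IsGreatest (Set.range fun i => S₀ i i) γ) :
    ∀ X Y : Matrix (Fin d) (Fin d) ℝ, X.PosDef → Y.PosDef →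
      (S₀ - X).PosSemidef → (S₀ - Y).PosSemidef → ∀ t : ℝ, t ∈ Set.Icc (0 : ℝ) 1 →
      -Real.log (t • X + (1 - t) • Y).det ≤
        -(t * Real.log X.det) - (1 - t) * Real.log Y.det -
          t * (1 - t) / 2 * (1 / (1152 * γ ^ 2 * (d : ℝ) ^ 3 * Real.sqrt (Real.exp 1))) *
            frobNorm (X - Y) ^ 2 := by
  intro X Y hX hY hSX hSY t ⟨ht₀, ht₁⟩
  obtain ⟨i₀, hi₀⟩ := hγ.1
  have hγ₀ : 0 < γ := hi₀ ▸ hS₀.diag_pos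
  have hd : 0 < (d : ℝ) := Nat.cast_pos.2 i₀.pos
  have htrace : S₀.trace ≤ d * γ := by
    simpa [trace] using Finset.sum_le_card_nsmul Finset.univ (fun i => S₀ i i) γ
      fun i _ => hγ.2 ⟨i, rfl⟩
  have hXM : X.trace ≤ d * γ := by
    have h := hSX.trace_nonneg
    rw [trace_sub] at h
    linarith
  have hYM : Y.trace ≤ d * γ := by
    have h := hSY.trace_nonneg
    rw [trace_sub] at h
    linarith
  have hmain := log_det_strongConcave_of_trace_le hX hY (mul_pos hd hγ₀) hXM hYM ht₀ ht₁
  have hexp : 1 ≤ √(Real.exp 1) := Real.one_le_sqrt.2 (Real.one_le_exp zero_le_one)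
  have hcoef : t * (1 - t) / 2 * (1 / (1152 * γ ^ 2 * (d : ℝ) ^ 3 * √(Real.exp 1))) *
      frobNorm (X - Y) ^ 2 ≤ t * (1 - t) * frobNorm (X - Y) ^ 2 / (4 * d * (d * γ) ^ 2) := by
    have hs : 0 ≤ 1 - t := sub_nonneg.2 ht₁
    have hden : 4 * d * (d * γ) ^ 2 ≤ 2 * (1152 * γ ^ 2 * (d : ℝ) ^ 3 * √(Real.exp 1)) := by
      have hpos : 0 < γ ^ 2 * (d : ℝ) ^ 3 := by positivity
      nlinarith
    calc t * (1 - t) / 2 * (1 / (1152 * γ ^ 2 * (d : ℝ) ^ 3 * √(Real.exp 1))) *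
          frobNorm (X - Y) ^ 2
        = t * (1 - t) * frobNorm (X - Y) ^ 2 /
            (2 * (1152 * γ ^ 2 * (d : ℝ) ^ 3 * √(Real.exp 1))) := by
          field_simp
      _ ≤ _ := by gcongr
  linarith
end

section
/- Let γ > 0 and let X, Y be d×d real positive semidefinite matrices all of whose diagonal entries are at most γ. Then there exists a pair of indices (i, j) with i, j ∈ {1,…,d} such that |X_{ij} − Y_{ij}| ≥ (‖X − Y‖_F / (4γ d^{3/2})) · (X_{ii} + Y_{ii} + X_{jj} + Y_{jj}). (Entry-separation step in the proof of Lemma 3.) -/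
open Matrix

/-- Entry-separation step in the proof of Lemma 3: for psd matrices `X, Y` with diagonal
entries at most `γ`, some entry difference is at least
`(‖X−Y‖_F / (4γ d^{3/2})) (Xᵢᵢ + Yᵢᵢ + Xⱼⱼ + Yⱼⱼ)`. -/
theorem stmt_4 {d : ℕ} (hd : 0 < d) (γ : ℝ) (hγ : 0 < γ)
    (X Y : Matrix (Fin d) (Fin d) ℝ) (hX : X.PosSemidef) (hY : Y.PosSemidef)
    (hXγ : ∀ i, X i i ≤ γ) (hYγ : ∀ i, Y i i ≤ γ) :
    ∃ i j : Fin d,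
      |X i j - Y i j| ≥
        frobNorm (X - Y) / (4 * γ * (d : ℝ) ^ ((3 : ℝ) / 2)) *
          (X i i + Y i i + X j j + Y j j) := by
  by_contra! h
  have hd1 : (1 : ℝ) ≤ d := by exact_mod_cast hd
  have hdpos : (0 : ℝ) < d := by linarith
  have : Nonempty (Fin d) := ⟨⟨0, hd⟩⟩
  set F := frobNorm (X - Y) with hF
  have hF0 : 0 ≤ F := Real.sqrt_nonneg _
  have hpow : (d : ℝ) ≤ (d : ℝ) ^ ((3 : ℝ) / 2) := by
    simpa using Real.rpow_le_rpow_of_exponent_le hd1 (by norm_num : (1 : ℝ) ≤ 3 / 2)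
  have hentry (i j : Fin d) : (X i j - Y i j) ^ 2 < (F / d) ^ 2 := by
    have hlt : |X i j - Y i j| < F / d := calc
      |X i j - Y i j| < _ := h i j
      _ ≤ F / (4 * γ * (d : ℝ) ^ ((3 : ℝ) / 2)) * (4 * γ) := by
        gcongr
        linarith [hXγ i, hYγ i, hXγ j, hYγ j]
      _ = F / (d : ℝ) ^ ((3 : ℝ) / 2) := by field_simp
      _ ≤ F / d := by gcongr
    exact sq_lt_sq' (abs_lt.mp hlt).1 (abs_lt.mp hlt).2
  have hFsq : F ^ 2 = ∑ i, ∑ j, (X i j - Y i j) ^ 2 := by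
    rw [hF, frobNorm, Real.sq_sqrt (by positivity)]
    rfl
  have hlt : ∑ i, ∑ j, (X i j - Y i j) ^ 2 < ∑ _i : Fin d, ∑ _j : Fin d, (F / d) ^ 2 :=
    Finset.sum_lt_sum_of_nonempty Finset.univ_nonempty fun i _ =>
      Finset.sum_lt_sum_of_nonempty Finset.univ_nonempty fun j _ => hentry i j
  have hsum : ∑ _i : Fin d, ∑ _j : Fin d, (F / d) ^ 2 = F ^ 2 := by
    simp only [Finset.sum_const, Finset.card_univ, Fintype.card_fin, nsmul_eq_mul]
    field_simp
  linarith
end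

section
/- Let W be a d×d real symmetric matrix with O ⪯ W ⪯ I. Then W can be written as a convex combination of finitely many d×d projection matrices: there exist n ∈ ℕ, projection matrices P₁, …, Pₙ, and nonnegative reals t₁, …, tₙ with Σₖ tₖ = 1 such that W = Σₖ tₖ Pₖ. (Lemma 7: any W in the relaxed set 𝒲 can be achieved by randomized linear policies.) -/
open Matrix

/-- Every point of the unit cube is a convex combination of its vertices. -/
lemma mem_convexHull_pi_zero_one {ι : Type*} [Finite ι] {v : ι → ℝ}
    (h0 : ∀ i, 0 ≤ v i) (h1 : ∀ i, v i ≤ 1) :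
    v ∈ convexHull ℝ (Set.univ.pi fun _ : ι => ({0, 1} : Set ℝ)) := by
  refine mem_convexHull_pi fun i _ => ?_
  rw [convexHull_pair, segment_eq_Icc zero_le_one]
  exact ⟨h0 i, h1 i⟩

/-- A symmetric matrix between `0` and `1` lies in the convex hull of the projection matrices. -/
lemma Matrix.PosSemidef.mem_convexHull_projections {ι : Type*} [Fintype ι] [DecidableEq ι]
    {W : Matrix ι ι ℝ} (hW : W.PosSemidef) (hW1 : (1 - W).PosSemidef) :
    W ∈ convexHull ℝ {P : Matrix ι ι ℝ | Pᵀ = P ∧ P * P = P} := by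
  have hH := hW.isHermitian
  set U : Matrix ι ι ℝ := hH.eigenvectorUnitary.val
  have hUU : Uᴴ * U = 1 := Unitary.coe_star_mul_self hH.eigenvectorUnitary
  have hspec : W = U * diagonal hH.eigenvalues * Uᴴ := by
    have h := hH.spectral_theorem
    rw [Unitary.conjStarAlgAut_apply] at h
    exact h
  have hdiag : Uᴴ * (1 - W) * U = diagonal fun i => 1 - hH.eigenvalues i := by
    have hW' : Uᴴ * W * U = diagonal hH.eigenvalues := by
      calc Uᴴ * W * U = (Uᴴ * U) * diagonal hH.eigenvalues * (Uᴴ * U) := by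
            conv_lhs => rw [hspec]
            simp only [Matrix.mul_assoc]
        _ = diagonal hH.eigenvalues := by rw [hUU, Matrix.one_mul, Matrix.mul_one]
    rw [Matrix.mul_sub, Matrix.sub_mul, hW', Matrix.mul_one, hUU, ← diagonal_one, diagonal_sub]
  have hle : ∀ i, hH.eigenvalues i ≤ 1 := by
    have h := hW1.conjTranspose_mul_mul_same U
    rw [hdiag, posSemidef_diagonal_iff] at h
    exact fun i => sub_nonneg.mp (h i)
  let L : (ι → ℝ) →ₗ[ℝ] Matrix ι ι ℝ :=
    LinearMap.mulRight ℝ Uᴴ ∘ₗ LinearMap.mulLeft ℝ U ∘ₗ Matrix.diagonalLinearMap ι ℝ ℝ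
  have hL : ∀ v, L v = U * diagonal v * Uᴴ := fun v => rfl
  have hmem := Set.mem_image_of_mem L (mem_convexHull_pi_zero_one hW.eigenvalues_nonneg hle)
  rw [L.image_convexHull, hL, ← hspec] at hmem
  refine convexHull_mono ?_ hmem
  rintro _ ⟨v, hv, rfl⟩
  have hvv : diagonal v * diagonal v = diagonal v := by
    rw [diagonal_mul_diagonal]
    congr 1
    funext i
    rcases hv i (Set.mem_univ i) with h | h <;> simp_all
  refine ⟨?_, ?_⟩
  · simp [hL, conjTranspose_eq_transpose_of_trivial, Matrix.mul_assoc]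
  · calc L v * L v = U * (diagonal v * (Uᴴ * U) * diagonal v) * Uᴴ := by
          simp only [hL, Matrix.mul_assoc]
      _ = L v := by rw [hUU, Matrix.mul_one, hvv, hL]

/-- Lemma 7: any symmetric `W` with `O ⪯ W ⪯ I` is a convex combination of finitely many
projection matrices (achievability by randomized linear policies). -/
theorem stmt_12 {d : ℕ} (W : Matrix (Fin d) (Fin d) ℝ)
    (hW : W.PosSemidef) (hW1 : ((1 : Matrix (Fin d) (Fin d) ℝ) - W).PosSemidef) :
    ∃ (n : ℕ) (P : Fin n → Matrix (Fin d) (Fin d) ℝ) (t : Fin n → ℝ),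
      (∀ k, (P k)ᵀ = P k ∧ P k * P k = P k) ∧
      (∀ k, 0 ≤ t k) ∧ (∑ k, t k) = 1 ∧ W = ∑ k, t k • P k := by
  obtain ⟨κ, _, t, P, ht, hsum, hP, hWP⟩ :=
    mem_convexHull_iff_exists_fintype.mp (hW.mem_convexHull_projections hW1)
  let e := (Fintype.equivFin κ).symm
  refine ⟨Fintype.card κ, P ∘ e, t ∘ e, fun k => hP (e k), fun k => ht (e k), ?_, ?_⟩
  · rw [← hsum]
    exact e.sum_comp t
  · rw [← hWP]
    exact (e.sum_comp fun i => t i • P i).symm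
end
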